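/- Let R be a nontrivial ring, let n, m ∈ ℕ with n < m, and let 1 → N → G → Q → 1 be a group extension, i.e., a surjective group homomorphism p : G → Q with kernel N. Suppose that every subgroup of Q of type FP_n(R) is of type FP_m(R), and that for every subgroup H of G of type FP_n(R) the intersection N ∩ H is of type FP_m(R). Then every subgroup of G of type FP_n(R) is of type FP_m(R). (This is the homological analogue of the Remark strengthening part (i) of the extension inheritance lemma: instead of assuming N is homologically (0,m)-coherent over R, it suffices that the intersection of any subgroup of G of type FP_n(R) with N is of type FP_m(R).) -/

import Mathlib

universe u v w

/-- The augmentation ring homomorphism `R[G] → R`, sending every group element to `1`. -/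
noncomputable def augmentation (R : Type u) [Ring R] (G : Type v) [Group G] :
    MonoidAlgebra R G →+* R :=
  MonoidAlgebra.liftNCRingHom (RingHom.id R) (1 : G →* R)
    (fun x y => by simp)

/-- `R` as a module over the group ring `R[G]`, with the trivial `G`-action. -/
noncomputable instance trivialGroupRingModule (R : Type u) [Ring R] (G : Type v) [Group G] :
    Module (MonoidAlgebra R G) R :=
  Module.compHom R (augmentation R G)

/-- A witness that a group `G` is of type `FP_n(R)`: an exact sequence
`P_n → P_{n-1} → ⋯ → P_1 → P_0 → R → 0` of left `R[G]`-modules (with `R` carrying the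
trivial `G`-action) in which each `P_i`, `i ≤ n`, is a finitely generated projective
`R[G]`-module.  The family of modules and differentials is indexed by all of `ℕ`, but
only the data in degrees `≤ n` is constrained; exactness is required at `R` (i.e. the
augmentation `ε` is surjective), at `P_0` (when `n ≥ 1`), and at `P_i` for
`1 ≤ i ≤ n - 1`. -/
structure FPWitness (R : Type u) [Ring R] (G : Type v) [Group G] (n : ℕ) where
  P : ℕ → Type w
  [addCommGroup : ∀ i, AddCommGroup (P i)]
  [module : ∀ i, Module (MonoidAlgebra R G) (P i)]
  d : ∀ i, P (i + 1) →ₗ[MonoidAlgebra R G] P i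
  ε : P 0 →ₗ[MonoidAlgebra R G] R
  finite : ∀ i ≤ n, Module.Finite (MonoidAlgebra R G) (P i)
  projective : ∀ i ≤ n, Module.Projective (MonoidAlgebra R G) (P i)
  surjective : Function.Surjective ε
  exact_zero : 0 < n → LinearMap.range (d 0) = LinearMap.ker ε
  exact : ∀ i, i + 2 ≤ n → LinearMap.range (d (i + 1)) = LinearMap.ker (d i)

/-- A group `G` is of type `FP_n(R)` if there exists an exact sequence
`P_n → ⋯ → P_0 → R → 0` of left `R[G]`-modules in which each `P_i` is a finitely
generated projective `R[G]`-module and `R` carries the trivial `G`-action. -/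
def Group.IsTypeFP (R : Type u) [Ring R] (G : Type v) [Group G] (n : ℕ) : Prop :=
  Nonempty (FPWitness.{u, v, max u v} R G n)

namespace FPAux

section Defs

variable {A : Type*} [Ring A]

/-- Finiteness property `FP_n` for submodules of finite free modules. -/
def SubFP (A : Type*) [Ring A] : ℕ → ∀ k : ℕ, Submodule A (Fin k → A) → Prop
  | 0, _, S => S.FG
  | n + 1, k, S => ∃ (j : ℕ) (f : (Fin j → A) →ₗ[A] (Fin k → A)),
      LinearMap.range f = S ∧ SubFP A n j (LinearMap.ker f)

/-- Finiteness property `FP_n` for modules. -/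
def FP (A : Type*) [Ring A] (n : ℕ) (M : Type*) [AddCommGroup M] [Module A M] : Prop :=
  match n with
  | 0 => Module.Finite A M
  | n + 1 => ∃ (k : ℕ) (f : (Fin k → A) →ₗ[A] M), Function.Surjective f ∧
      SubFP A n k (LinearMap.ker f)

theorem FP_zero {M : Type*} [AddCommGroup M] [Module A M] : FP A 0 M ↔ Module.Finite A M := Iff.rfl

theorem subFP_iff (n k : ℕ) (S : Submodule A (Fin k → A)) : SubFP A n k S ↔ FP A n S := by
  cases n with
  | zero => exact Module.Finite.iff_fg.symm
  | succ n =>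
    constructor
    · rintro ⟨j, f, rfl, h⟩
      refine ⟨j, f.rangeRestrict, LinearMap.surjective_rangeRestrict f, ?_⟩
      rwa [LinearMap.ker_rangeRestrict]
    · rintro ⟨j, f, hf, h⟩
      refine ⟨j, S.subtype ∘ₗ f, ?_, ?_⟩
      · rw [LinearMap.range_comp, LinearMap.range_eq_top.2 hf]; simp
      · rwa [LinearMap.ker_comp_of_ker_eq_bot _ (Submodule.ker_subtype S)]

theorem FP_succ {n : ℕ} {M : Type*} [AddCommGroup M] [Module A M] :
    FP A (n + 1) M ↔ ∃ (k : ℕ) (f : (Fin k → A) →ₗ[A] M), Function.Surjective f ∧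
      FP A n (LinearMap.ker f) := by
  simp only [← subFP_iff]; rfl

variable {M M' M'' : Type*} [AddCommGroup M] [Module A M] [AddCommGroup M'] [Module A M']
  [AddCommGroup M''] [Module A M'']

theorem FP.of_equiv {n : ℕ} (e : M ≃ₗ[A] M') (h : FP A n M) : FP A n M' := by
  cases n with
  | zero =>
    have : Module.Finite A M := h
    exact Module.Finite.equiv e
  | succ n =>
    obtain ⟨k, f, hf, h⟩ := h
    refine ⟨k, e.toLinearMap ∘ₗ f, e.surjective.comp hf, ?_⟩
    rwa [LinearMap.ker_comp_of_ker_eq_bot _ (LinearEquiv.ker e)]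

theorem FP.succ_of_equiv {n k : ℕ} (e : (Fin k → A) ≃ₗ[A] M') (f : M' →ₗ[A] M)
    (hf : Function.Surjective f) (h : FP A n (LinearMap.ker f)) : FP A (n + 1) M := by
  rw [FP_succ]
  refine ⟨k, f ∘ₗ e.toLinearMap, hf.comp e.surjective, ?_⟩
  exact FP.of_equiv (LinearEquiv.ofSubmodule' e (LinearMap.ker f)).symm h

theorem FP.finite {n : ℕ} (h : FP A n M) : Module.Finite A M := by
  cases n with
  | zero => exact h
  | succ n =>
    obtain ⟨k, f, hf, -⟩ := h
    exact Module.Finite.of_surjective f hf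

/-- The equivalence between a product of finite free modules and a finite free module. -/
def prodEquiv (A : Type*) [Ring A] (j k : ℕ) :
    (Fin (j + k) → A) ≃ₗ[A] ((Fin j → A) × (Fin k → A)) :=
  (LinearEquiv.funCongrLeft A A finSumFinEquiv).trans
    (LinearEquiv.sumArrowLequivProdArrow (Fin j) (Fin k) A A)

end Defs

theorem ext_step {A : Type*} [Ring A] {n : ℕ} {M : Type*} {M' : Type*} {M'' : Type*}
    [AddCommGroup M] [Module A M] [AddCommGroup M'] [Module A M']
    [AddCommGroup M''] [Module A M'']
    (ih : ∀ (j k : ℕ) (S' : Submodule A (Fin j → A))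
      (S : Submodule A ((Fin j → A) × (Fin k → A))) (S'' : Submodule A (Fin k → A))
      (i : S' →ₗ[A] S) (p : S →ₗ[A] S''), Function.Surjective p → Function.Exact i p →
      Function.Injective i → FP A n S' → FP A n S'' → FP A n S)
    (i : M' →ₗ[A] M) (p : M →ₗ[A] M'') (hp : Function.Surjective p)
    (hex : Function.Exact i p) (hi : Function.Injective i)
    (h' : FP A (n + 1) M') (h'' : FP A (n + 1) M'') : FP A (n + 1) M := by
  rw [FP_succ] at h' h''
  obtain ⟨j, f', hf', h'⟩ := h'
  obtain ⟨k, f'', hf'', h''⟩ := h''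
  obtain ⟨g, hg⟩ := Module.projective_lifting_property p f'' hp
  have hg' : ∀ y, p (g y) = f'' y := fun y => LinearMap.congr_fun hg y
  have hpi : ∀ x, p (i x) = 0 := fun x => (hex (i x)).2 ⟨x, rfl⟩
  let φ : (Fin j → A) × (Fin k → A) →ₗ[A] M := LinearMap.coprod (i ∘ₗ f') g
  have hφ : ∀ z, φ z = i (f' z.1) + g z.2 := fun z => rfl
  have hφs : Function.Surjective φ := by
    intro m
    obtain ⟨y, hy⟩ := hf'' (p m)
    obtain ⟨m', hm'⟩ := (hex (m - g y)).1 (by rw [map_sub, hg', hy, sub_self])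
    obtain ⟨x, rfl⟩ := hf' m'
    exact ⟨(x, y), by rw [hφ, hm']; simp⟩
  refine FP.succ_of_equiv (prodEquiv A j k) φ hφs ?_
  let a : LinearMap.ker f' →ₗ[A] LinearMap.ker φ :=
    (LinearMap.inl A (Fin j → A) (Fin k → A)).restrict (by
      intro x hx
      simp only [LinearMap.mem_ker] at hx ⊢
      rw [hφ]; simp [hx])
  let b : LinearMap.ker φ →ₗ[A] LinearMap.ker f'' :=
    (LinearMap.snd A (Fin j → A) (Fin k → A)).restrict (by
      intro z hz
      simp only [LinearMap.mem_ker] at hz ⊢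
      rw [hφ] at hz
      have := congrArg p hz
      simpa [hpi, hg'] using this)
  refine ih j k _ _ _ a b ?_ ?_ ?_ h' h''
  · rintro ⟨y, hy⟩
    obtain ⟨m', hm'⟩ := (hex (g y)).1 (by rw [hg']; exact hy)
    obtain ⟨x, rfl⟩ := hf' m'
    refine ⟨⟨(-x, y), ?_⟩, rfl⟩
    rw [LinearMap.mem_ker, hφ]
    simp [hm']
  · rintro ⟨⟨x, y⟩, hz⟩
    constructor
    · intro h
      have hy : y = 0 := congrArg Subtype.val h
      subst hy
      refine ⟨⟨x, ?_⟩, rfl⟩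
      rw [LinearMap.mem_ker, hφ] at hz
      rw [LinearMap.mem_ker]
      apply hi
      simpa using hz
    · rintro ⟨x', hx'⟩
      rw [← hx']
      rfl
  · rintro ⟨x, hx⟩ ⟨x', hx'⟩ h
    have : (x, (0 : Fin k → A)) = (x', 0) := congrArg Subtype.val h
    simpa using this

theorem ext_zero {A : Type*} [Ring A] {M : Type*} {M' : Type*} {M'' : Type*}
    [AddCommGroup M] [Module A M] [AddCommGroup M'] [Module A M']
    [AddCommGroup M''] [Module A M'']
    (i : M' →ₗ[A] M) (p : M →ₗ[A] M'') (hp : Function.Surjective p)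
    (hex : Function.Exact i p)
    (h' : FP A 0 M') (h'' : FP A 0 M'') : FP A 0 M := by
  rw [FP_zero] at *
  have h1 : (LinearMap.ker p).FG := by
    rw [LinearMap.exact_iff.1 hex]
    exact (Module.Finite.iff_fg).1 inferInstance
  have h2 : (LinearMap.range p).FG := by
    rw [LinearMap.range_eq_top.2 hp]; exact Module.Finite.fg_top
  exact ⟨Submodule.fg_of_fg_map_of_fg_inf_ker p (by simpa using h2) (by simpa using h1)⟩

theorem ext_univ.{a} {A : Type a} [Ring A] {n : ℕ} {M M' M'' : Type a}
    [AddCommGroup M] [Module A M] [AddCommGroup M'] [Module A M']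
    [AddCommGroup M''] [Module A M'']
    (i : M' →ₗ[A] M) (p : M →ₗ[A] M'') (hp : Function.Surjective p)
    (hex : Function.Exact i p) (hi : Function.Injective i)
    (h' : FP A n M') (h'' : FP A n M'') : FP A n M := by
  induction n generalizing M M' M'' with
  | zero => exact ext_zero i p hp hex h' h''
  | succ n ih =>
    exact ext_step (fun j k S' S S'' i p hp hex hi h' h'' => ih i p hp hex hi h' h'')
      i p hp hex hi h' h''

section

variable {A : Type*} [Ring A] {M M' M'' : Type*} [AddCommGroup M] [Module A M] [AddCommGroup M']
  [Module A M'] [AddCommGroup M''] [Module A M'']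

theorem FP.ext {n : ℕ}
    (i : M' →ₗ[A] M) (p : M →ₗ[A] M'') (hp : Function.Surjective p)
    (hex : Function.Exact i p) (hi : Function.Injective i)
    (h' : FP A n M') (h'' : FP A n M'') : FP A n M := by
  cases n with
  | zero => exact ext_zero i p hp hex h' h''
  | succ n =>
    exact ext_step (fun j k S' S S'' i p hp hex hi h' h'' => ext_univ i p hp hex hi h' h'')
      i p hp hex hi h' h''

theorem FP.pred {n : ℕ} (h : FP A (n + 1) M) : FP A n M := by
  have key : ∀ (n k : ℕ) (S : Submodule A (Fin k → A)), SubFP A (n + 1) k S → SubFP A n k S := by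
    intro n
    induction n with
    | zero =>
      rintro k S ⟨j, f, rfl, -⟩
      exact (Module.Finite.iff_fg).1 inferInstance
    | succ n ih =>
      rintro k S ⟨j, f, hf, h⟩
      exact ⟨j, f, hf, ih _ _ h⟩
  cases n with
  | zero => exact h.finite
  | succ n =>
    obtain ⟨k, f, hf, h⟩ := h
    exact ⟨k, f, hf, key _ _ _ h⟩

theorem FP.mono {n m : ℕ} (hnm : n ≤ m) (h : FP A m M) : FP A n M := by
  induction hnm with
  | refl => exact h
  | step _ ih => exact ih h.pred

theorem FP.of_subsingleton [Subsingleton M] (n : ℕ) : FP A n M := by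
  have key : ∀ (n k : ℕ), SubFP A n k ⊥ := by
    intro n
    induction n with
    | zero => intro k; exact Submodule.fg_bot
    | succ n ih =>
      intro k
      refine ⟨0, 0, LinearMap.range_zero, ?_⟩
      rw [Subsingleton.elim (LinearMap.ker _) ⊥]
      exact ih 0
  cases n with
  | zero => rw [FP_zero]; infer_instance
  | succ n =>
    refine ⟨0, 0, fun x => ⟨0, Subsingleton.elim _ _⟩, ?_⟩
    rw [Subsingleton.elim (LinearMap.ker _) ⊥]
    exact key n 0

theorem FP.free (n k : ℕ) : FP A n (Fin k → A) := by
  cases n with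
  | zero => rw [FP_zero]; infer_instance
  | succ n =>
    refine FP.succ_of_equiv (LinearEquiv.refl A _) LinearMap.id Function.surjective_id ?_
    rw [LinearMap.ker_id]
    exact FP.of_subsingleton n

/-- Quotients. -/
theorem FP.quot_succ {n : ℕ}
    (i : M' →ₗ[A] M) (p : M →ₗ[A] M'') (hp : Function.Surjective p)
    (hex : Function.Exact i p) (hi : Function.Injective i)
    (h' : FP A n M') (h : FP A (n + 1) M) : FP A (n + 1) M'' := by
  rw [FP_succ] at h ⊢
  obtain ⟨k, f, hf, h⟩ := h
  refine ⟨k, p ∘ₗ f, hp.comp hf, ?_⟩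
  have hpi : ∀ x, p (i x) = 0 := fun x => (hex (i x)).2 ⟨x, rfl⟩
  let e : M' ≃ₗ[A] LinearMap.ker p :=
    (LinearEquiv.ofInjective i hi).trans (LinearEquiv.ofEq _ _ (LinearMap.exact_iff.1 hex).symm)
  let a : LinearMap.ker f →ₗ[A] LinearMap.ker (p ∘ₗ f) :=
    Submodule.inclusion (LinearMap.ker_le_ker_comp f p)
  let b : LinearMap.ker (p ∘ₗ f) →ₗ[A] LinearMap.ker p :=
    f.restrict (fun x hx => hx)
  refine FP.ext a b ?_ ?_ ?_ h (h'.of_equiv e)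
  · rintro ⟨y, hy⟩
    obtain ⟨x, rfl⟩ := hf y
    exact ⟨⟨x, hy⟩, rfl⟩
  · rintro ⟨x, hx⟩
    constructor
    · intro h
      have : f x = 0 := congrArg Subtype.val h
      exact ⟨⟨x, this⟩, rfl⟩
    · rintro ⟨⟨y, hy⟩, h⟩
      rw [← h]
      exact Subtype.ext hy
  · exact Submodule.inclusion_injective _

theorem FP.quot {n : ℕ}
    (i : M' →ₗ[A] M) (p : M →ₗ[A] M'') (hp : Function.Surjective p)
    (hex : Function.Exact i p) (hi : Function.Injective i)
    (h' : FP A n M') (h : FP A n M) : FP A n M'' := by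
  cases n with
  | zero =>
    have := h.finite
    exact Module.Finite.of_surjective p hp
  | succ n => exact FP.quot_succ i p hp hex hi h'.pred h

theorem FP.ker {n : ℕ} (p : M →ₗ[A] M'') (hp : Function.Surjective p)
    (h : FP A n M) (h'' : FP A (n + 1) M'') : FP A n (LinearMap.ker p) := by
  rw [FP_succ] at h''
  obtain ⟨k, g, hg, h''⟩ := h''
  obtain ⟨s, hs⟩ := Module.projective_lifting_property p g hp
  have hs' : ∀ y, p (s y) = g y := fun y => LinearMap.congr_fun hs y
  -- the map `ker p × A^k → M`, `(x, y) ↦ x + s y` is onto with kernel `ker g`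
  let φ : LinearMap.ker p × (Fin k → A) →ₗ[A] M := LinearMap.coprod (Submodule.subtype _) s
  have hφ : ∀ z, φ z = (z.1 : M) + s z.2 := fun z => rfl
  let c : LinearMap.ker g →ₗ[A] LinearMap.ker p :=
    s.restrict (fun y hy => by rw [LinearMap.mem_ker] at hy ⊢; rw [hs', hy])
  let b : LinearMap.ker g →ₗ[A] LinearMap.ker p × (Fin k → A) :=
    LinearMap.prod (-c) (Submodule.subtype _)
  have hX : FP A n (LinearMap.ker p × (Fin k → A)) := by
    refine FP.ext b φ ?_ ?_ ?_ h'' h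
    · intro m
      obtain ⟨y, hy⟩ := hg (p m)
      refine ⟨(⟨m - s y, ?_⟩, y), ?_⟩
      · rw [LinearMap.mem_ker, map_sub, hs', hy, sub_self]
      · rw [hφ]; simp
    · rintro ⟨⟨x, hx⟩, y⟩
      rw [LinearMap.mem_ker] at hx
      constructor
      · intro h
        rw [hφ] at h
        refine ⟨⟨y, ?_⟩, ?_⟩
        · have := congrArg p h
          simpa [hx, hs'] using this
        · refine Prod.ext (Subtype.ext ?_) rfl
          exact (eq_neg_of_add_eq_zero_left h).symm
      · rintro ⟨y', h⟩
        rw [← h, hφ]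
        exact neg_add_cancel _
    · intro y y' h
      exact Subtype.ext (congrArg Prod.snd h)
  exact FP.quot (LinearMap.inr A (LinearMap.ker p) (Fin k → A)) (LinearMap.fst A _ _)
    LinearMap.fst_surjective Function.Exact.inr_fst LinearMap.inr_injective (FP.free n k) hX

theorem FP.pi {n : ℕ} (h : FP A n M) (k : ℕ) : FP A n (Fin k → M) := by
  induction k with
  | zero => exact FP.of_subsingleton n
  | succ k ih =>
    refine FP.of_equiv (Fin.consLinearEquiv A (fun _ : Fin (k + 1) => M)) ?_
    exact FP.ext (LinearMap.inl A M (Fin k → M)) (LinearMap.snd A _ _)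
      LinearMap.snd_surjective Function.Exact.inl_snd LinearMap.inl_injective h ih

theorem exact_subtype_ker (p : M →ₗ[A] M'') :
    Function.Exact (LinearMap.ker p).subtype p := LinearMap.exact_subtype_ker_map p

end

theorem proj_univ.{a} {A : Type a} [Ring A] (n : ℕ) (P : Type a) [AddCommGroup P] [Module A P]
    [Module.Finite A P] [Module.Projective A P] : FP A n P := by
  induction n generalizing P with
  | zero => rw [FP_zero]; infer_instance
  | succ n ih =>
    obtain ⟨k, f, hf⟩ := Module.Finite.exists_fin' A P
    obtain ⟨s, hs⟩ := Module.projective_lifting_property f LinearMap.id hf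
    have hs' : ∀ y, f (s y) = y := fun y => LinearMap.congr_fun hs y
    rw [FP_succ]
    refine ⟨k, f, hf, ?_⟩
    let r : (Fin k → A) →ₗ[A] LinearMap.ker f :=
      (LinearMap.id - s ∘ₗ f).codRestrict _ (fun x => by simp [hs'])
    have hr : r ∘ₗ (LinearMap.ker f).subtype = LinearMap.id := by
      ext ⟨x, hx⟩ : 2
      rw [LinearMap.mem_ker] at hx
      simp [r, hx]
    have : Module.Projective A (LinearMap.ker f) := Module.Projective.of_split _ r hr
    have : Module.Finite A (LinearMap.ker f) :=
      Module.Finite.of_surjective r (fun x => ⟨x, LinearMap.congr_fun hr x⟩)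
    exact ih _

theorem up_univ.{a, b} {A : Type a} {B : Type b} [Ring A] [Ring B] [Module A B]
    [IsScalarTower A B B] (n : ℕ) (hB : FP A n B) (X : Type b) [AddCommGroup X] [Module A X]
    [Module B X] [IsScalarTower A B X] (hX : FP B n X) : FP A n X := by
  induction n generalizing X with
  | zero =>
    have := hX.finite
    have := hB.finite
    obtain ⟨k, f, hf⟩ := Module.Finite.exists_fin' B X
    exact Module.Finite.of_surjective (f.restrictScalars A) hf
  | succ n ih =>
    rw [FP_succ] at hX
    obtain ⟨k, f, hf, h⟩ := hX
    have h2 := ih hB.pred _ h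
    exact FP.quot_succ ((LinearMap.ker f).subtype.restrictScalars A) (f.restrictScalars A) hf
      (exact_subtype_ker f) (Subtype.val_injective) h2 (hB.pi k)

theorem down_univ.{a, b} {A : Type a} {B : Type b} [Ring A] [Ring B] [Module A B]
    [IsScalarTower A B B] (n : ℕ) (hB : FP A n B) (X : Type b) [AddCommGroup X] [Module A X]
    [Module B X] [IsScalarTower A B X] (hX : FP A n X) : FP B n X := by
  induction n generalizing X with
  | zero =>
    have := hX.finite
    exact Module.Finite.of_restrictScalars_finite A B X
  | succ n ih =>
    have := hX.finite
    have := Module.Finite.of_restrictScalars_finite A B X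
    obtain ⟨k, f, hf⟩ := Module.Finite.exists_fin' B X
    rw [FP_succ]
    refine ⟨k, f, hf, ih hB.pred _ ?_⟩
    exact FP.ker (f.restrictScalars A) hf (hB.pred.pi k) hX

end FPAux

namespace FPAux

theorem of_resolution.{a} {A : Type a} [Ring A] (n : ℕ) (M : Type a) [AddCommGroup M] [Module A M]
    (P : ℕ → Type a) [∀ i, AddCommGroup (P i)] [∀ i, Module A (P i)]
    (d : ∀ i, P (i + 1) →ₗ[A] P i) (ε : P 0 →ₗ[A] M)
    (hfin : ∀ i ≤ n, Module.Finite A (P i)) (hproj : ∀ i ≤ n, Module.Projective A (P i))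
    (hsurj : Function.Surjective ε) (h0 : 0 < n → LinearMap.range (d 0) = LinearMap.ker ε)
    (hex : ∀ i, i + 2 ≤ n → LinearMap.range (d (i + 1)) = LinearMap.ker (d i)) : FP A n M := by
  have := hfin 0 (Nat.zero_le _)
  have := hproj 0 (Nat.zero_le _)
  induction n generalizing M P with
  | zero => exact Module.Finite.of_surjective ε hsurj
  | succ n ih =>
    have h0' := h0 (Nat.succ_pos n)
    have hmem : ∀ x, d 0 x ∈ LinearMap.ker ε := fun x => by rw [← h0']; exact ⟨x, rfl⟩
    have key : FP A n (LinearMap.ker ε) := by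
      refine ih (LinearMap.ker ε) (fun i => P (i + 1)) (fun i => d (i + 1))
        ((d 0).codRestrict _ hmem) (fun i hi => hfin _ (by omega)) (fun i hi => hproj _ (by omega))
        ?_ ?_ (fun i hi => hex _ (by omega)) ?_ ?_
      · rintro ⟨y, hy⟩
        rw [← h0'] at hy
        obtain ⟨x, rfl⟩ := hy
        exact ⟨x, rfl⟩
      · intro hn
        rw [LinearMap.ker_codRestrict]
        exact hex 0 (by omega)
      · exact hfin 1 (by omega)
      · exact hproj 1 (by omega)
    exact FP.quot_succ (LinearMap.ker ε).subtype ε hsurj (exact_subtype_ker ε)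
      Subtype.val_injective key (proj_univ _ _)

theorem exists_resolution {A : Type*} [Ring A] (n : ℕ) (k : ℕ) (S : Submodule A (Fin k → A))
    (hS : SubFP A n k S) : ∃ (r : ℕ → ℕ)
      (d : ∀ i, (Fin (r (i + 1)) → A) →ₗ[A] (Fin (r i) → A))
      (ε : (Fin (r 0) → A) →ₗ[A] (Fin k → A)), LinearMap.range ε = S ∧
      (0 < n → LinearMap.range (d 0) = LinearMap.ker ε) ∧
      (∀ i, i + 2 ≤ n → LinearMap.range (d (i + 1)) = LinearMap.ker (d i)) := by
  induction n generalizing k with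
  | zero =>
    have : Module.Finite A S := Module.Finite.iff_fg.2 hS
    obtain ⟨j, f, hf⟩ := Module.Finite.exists_fin' A S
    refine ⟨fun _ => j, fun _ => 0, S.subtype ∘ₗ f, ?_, by simp, by simp⟩
    rw [LinearMap.range_comp, LinearMap.range_eq_top.2 hf]; simp
  | succ n ih =>
    obtain ⟨j, f, hf, h⟩ := hS
    obtain ⟨r, d, ε, hε, h0, hex⟩ := ih j _ h
    let r' : ℕ → ℕ := fun i => Nat.casesOn i j r
    let d' : ∀ i, (Fin (r' (i + 1)) → A) →ₗ[A] (Fin (r' i) → A) := fun i =>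
      match i with
      | 0 => ε
      | i + 1 => d i
    refine ⟨r', d', f, hf, fun _ => hε, ?_⟩
    intro i hi
    cases i with
    | zero => exact h0 (by omega)
    | succ i => exact hex i (by omega)

theorem isTypeFP_iff.{u', v'} (R : Type u') [Ring R] (G : Type v') [Group G] (n : ℕ) :
    Group.IsTypeFP R G n ↔ FP (MonoidAlgebra R G) n R := by
  constructor
  · rintro ⟨W⟩
    let _ := W.addCommGroup
    let _ := W.module
    let e : ULift.{v'} R ≃ₗ[MonoidAlgebra R G] R := ULift.moduleEquiv
    refine FP.of_equiv e ?_
    refine of_resolution n (ULift.{v'} R) W.P W.d (e.symm.toLinearMap ∘ₗ W.ε) W.finite W.projective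
      (e.symm.surjective.comp W.surjective) ?_ W.exact
    rw [LinearMap.ker_comp_of_ker_eq_bot _ (LinearEquiv.ker e.symm)]
    exact W.exact_zero
  · intro h
    cases n with
    | zero =>
      have := h.finite
      obtain ⟨k, f, hf⟩ := Module.Finite.exists_fin' (MonoidAlgebra R G) R
      exact ⟨{ P := fun _ => Fin k → MonoidAlgebra R G
               d := fun _ => 0
               ε := f
               finite := fun i hi => inferInstance
               projective := fun i hi => inferInstance
               surjective := hf
               exact_zero := by simp
               exact := by simp }⟩
    | succ n =>
      obtain ⟨k, f, hf, h⟩ := h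
      obtain ⟨r, d, ε, hε, h0, hex⟩ := exists_resolution n k _ h
      let r' : ℕ → ℕ := fun i => Nat.casesOn i k r
      let d' : ∀ i, (Fin (r' (i + 1)) → MonoidAlgebra R G) →ₗ[MonoidAlgebra R G]
          (Fin (r' i) → MonoidAlgebra R G) := fun i =>
        match i with
        | 0 => ε
        | i + 1 => d i
      have hF : ∀ j : ℕ, Module.Finite (MonoidAlgebra R G) (Fin j → MonoidAlgebra R G) :=
        fun j => inferInstance
      have hP : ∀ j : ℕ, Module.Projective (MonoidAlgebra R G) (Fin j → MonoidAlgebra R G) :=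
        fun j => inferInstance
      exact ⟨{ P := fun i => Fin (r' i) → MonoidAlgebra R G
               d := d'
               ε := f
               finite := fun i hi => hF (r' i)
               projective := fun i hi => hP (r' i)
               surjective := hf
               exact_zero := fun _ => hε
               exact := by
                intro i hi
                cases i with
                | zero => exact h0 (by omega)
                | succ i => exact hex i (by omega) }⟩

section Ind

variable {C A : Type*} [Ring C] [Ring A] (ι : C →+* A)

/-- The map `C^k → A^k` induced by a ring homomorphism. -/
def mapv {k : ℕ} (v : Fin k → C) : Fin k → A := fun i => ι (v i)

/-- The induced submodule. -/
def Ind {k : ℕ} (S : Submodule C (Fin k → C)) : Submodule A (Fin k → A) :=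
  Submodule.span A (mapv ι '' (S : Set (Fin k → C)))

/-- `A` is generated as a right `C`-module by the `τ t`. -/
def Gen {T : Type*} (τ : T → A) : Prop :=
  ∀ a : A, ∃ c : T →₀ C, c.sum (fun t x => τ t * ι x) = a

theorem gen_pi {T : Type*} {τ : T → A} (h : Gen ι τ) {k : ℕ} (v : Fin k → A) :
    ∃ w : T →₀ (Fin k → C), w.sum (fun t x => τ t • mapv ι x) = v := by
  classical
  choose c hc using h
  let w : T →₀ (Fin k → C) := Finsupp.onFinset (Finset.univ.biUnion fun i => (c (v i)).support)
    (fun t i => c (v i) t) (by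
      intro t ht
      obtain ⟨i, hi⟩ := Function.ne_iff.1 ht
      exact Finset.mem_biUnion.2 ⟨i, Finset.mem_univ _, Finsupp.mem_support_iff.2 hi⟩)
  have hw : ∀ t i, w t i = c (v i) t := fun t i => rfl
  refine ⟨w, ?_⟩
  ext i
  rw [← hc (v i), Finsupp.sum, Finset.sum_apply]
  rw [Finsupp.sum_of_support_subset (s := w.support) (c (v i)) _ _ (by simp)]
  · rfl
  · intro t ht
    rw [Finsupp.mem_support_iff] at ht ⊢
    intro h
    exact ht (by rw [← hw, h]; rfl)

variable {X Y : Type*} [AddCommGroup X] [Module C X] [AddCommGroup Y] [Module A Y]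

/-- The induced map. -/
noncomputable def indMap {j : ℕ} (f : (Fin j → C) →ₗ[C] X) (θ : X →+ Y) : (Fin j → A) →ₗ[A] Y :=
  Fintype.linearCombination A (fun i => θ (f (Pi.single i 1)))

theorem indMap_mapv {j : ℕ} (f : (Fin j → C) →ₗ[C] X) (θ : X →+ Y)
    (hθ : ∀ c x, θ (c • x) = ι c • θ x) (v : Fin j → C) :
    indMap f θ (mapv ι v) = θ (f v) := by
  classical
  rw [indMap, Fintype.linearCombination_apply]
  conv_rhs => rw [pi_eq_sum_univ' v, map_sum, map_sum]
  refine Finset.sum_congr rfl fun i _ => ?_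
  rw [map_smul, hθ]
  rfl

theorem indMap_sum {T : Type*} {τ : T → A} {j : ℕ} (f : (Fin j → C) →ₗ[C] X) (θ : X →+ Y)
    (hθ : ∀ c x, θ (c • x) = ι c • θ x) (w : T →₀ (Fin j → C)) :
    indMap f θ (w.sum (fun t x => τ t • mapv ι x)) = w.sum (fun t x => τ t • θ (f x)) := by
  rw [Finsupp.sum, map_sum]
  refine Finset.sum_congr rfl fun i _ => ?_
  rw [map_smul, indMap_mapv ι f θ hθ]

theorem ker_indMap {T : Type*} {τ : T → A} (hgen : Gen ι τ) {j : ℕ}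
    (f : (Fin j → C) →ₗ[C] X) (θ : X →+ Y) (hθ : ∀ c x, θ (c • x) = ι c • θ x)
    (hind : ∀ x : T →₀ X, x.sum (fun t x => τ t • θ x) = 0 → x = 0) :
    LinearMap.ker (indMap (A := A) f θ) = Ind ι (LinearMap.ker f) := by
  apply le_antisymm
  · intro v hv
    obtain ⟨w, rfl⟩ := gen_pi ι hgen v
    rw [LinearMap.mem_ker, indMap_sum ι f θ hθ] at hv
    have h0 : w.mapRange f (map_zero f) = 0 := by
      apply hind
      rw [Finsupp.sum_mapRange_index]
      · exact hv
      · simp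
    refine Submodule.sum_mem _ fun t _ => Submodule.smul_mem _ _ (Submodule.subset_span ⟨w t, ?_, rfl⟩)
    exact DFunLike.congr_fun h0 t
  · refine Submodule.span_le.2 ?_
    rintro _ ⟨v, hv, rfl⟩
    have hv' : f v = 0 := hv
    rw [SetLike.mem_coe, LinearMap.mem_ker, indMap_mapv ι f θ hθ, hv', map_zero]

def mapvHom {k : ℕ} : (Fin k → C) →+ (Fin k → A) where
  toFun := mapv ι
  map_zero' := by ext i; simp [mapv]
  map_add' x y := by ext i; simp [mapv]

theorem mapvHom_smul {k : ℕ} (c : C) (x : Fin k → C) :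
    mapvHom ι (c • x) = ι c • mapvHom ι x := by
  ext i; simp [mapvHom, mapv]

theorem range_indMap {T : Type*} {τ : T → A} (hgen : Gen ι τ) {j k : ℕ}
    (f : (Fin j → C) →ₗ[C] (Fin k → C)) :
    LinearMap.range (indMap f (mapvHom ι)) = Ind ι (LinearMap.range f) := by
  apply le_antisymm
  · rintro _ ⟨v, rfl⟩
    obtain ⟨w, rfl⟩ := gen_pi ι hgen v
    rw [indMap_sum ι f _ (mapvHom_smul ι)]
    exact Submodule.sum_mem _ fun t _ =>
      Submodule.smul_mem _ _ (Submodule.subset_span ⟨f (w t), ⟨_, rfl⟩, rfl⟩)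
  · refine Submodule.span_le.2 ?_
    rintro _ ⟨_, ⟨v, rfl⟩, rfl⟩
    exact ⟨mapv ι v, indMap_mapv ι f _ (mapvHom_smul ι) v⟩

theorem ind_pi {T : Type*} {τ : T → A}
    (hind : ∀ x : T →₀ C, x.sum (fun t x => τ t * ι x) = 0 → x = 0) {k : ℕ}
    (x : T →₀ (Fin k → C)) (hx : x.sum (fun t x => τ t • mapvHom ι x) = 0) : x = 0 := by
  have : ∀ i, x.mapRange (fun v => v i) rfl = 0 := by
    intro i
    apply hind
    rw [Finsupp.sum_mapRange_index (by simp)]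
    have := congrFun hx i
    rw [Finsupp.sum, Finset.sum_apply] at this
    exact this
  ext t i
  exact DFunLike.congr_fun (this i) t

theorem subFP_ind {T : Type*} {τ : T → A} (hgen : Gen ι τ)
    (hind : ∀ x : T →₀ C, x.sum (fun t x => τ t * ι x) = 0 → x = 0) (n k : ℕ)
    (S : Submodule C (Fin k → C)) (hS : SubFP C n k S) : SubFP A n k (Ind ι S) := by
  classical
  induction n generalizing k with
  | zero =>
    have : Module.Finite C S := Module.Finite.iff_fg.2 hS
    obtain ⟨j, f, hf⟩ := Module.Finite.exists_fin' C S
    have : S = LinearMap.range (S.subtype ∘ₗ f) := by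
      rw [LinearMap.range_comp, LinearMap.range_eq_top.2 hf]; simp
    rw [this, ← range_indMap ι hgen]
    exact (Module.Finite.iff_fg).1 inferInstance
  | succ n ih =>
    obtain ⟨j, f, rfl, h⟩ := hS
    refine ⟨j, indMap f (mapvHom ι), range_indMap ι hgen f, ?_⟩
    rw [ker_indMap ι hgen f _ (mapvHom_smul ι) (ind_pi ι hind)]
    exact ih _ _ h

theorem FP.ind {T : Type*} {τ : T → A} (hgen : Gen ι τ)
    (hind : ∀ x : T →₀ C, x.sum (fun t x => τ t * ι x) = 0 → x = 0)
    (θ : X →+ Y) (hθ : ∀ c x, θ (c • x) = ι c • θ x)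
    (hindX : ∀ x : T →₀ X, x.sum (fun t x => τ t • θ x) = 0 → x = 0)
    (hspan : ∀ y, ∃ x : T →₀ X, x.sum (fun t x => τ t • θ x) = y) (n : ℕ) (hX : FP C n X) :
    FP A n Y := by
  have hsurj : ∀ (k : ℕ) (f : (Fin k → C) →ₗ[C] X), Function.Surjective f →
      Function.Surjective (indMap (A := A) f θ) := by
    intro k f hf y
    obtain ⟨x, rfl⟩ := hspan y
    choose g hg using hf
    refine ⟨∑ t ∈ x.support, τ t • mapv ι (g (x t)), ?_⟩
    rw [map_sum]
    refine Finset.sum_congr rfl fun t _ => ?_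
    rw [map_smul, indMap_mapv ι f θ hθ, hg]
  cases n with
  | zero =>
    have := hX.finite
    obtain ⟨k, f, hf⟩ := Module.Finite.exists_fin' C X
    exact Module.Finite.of_surjective _ (hsurj k f hf)
  | succ n =>
    obtain ⟨k, f, hf, h⟩ := hX
    refine ⟨k, indMap f θ, hsurj k f hf, ?_⟩
    rw [ker_indMap ι hgen f θ hθ hindX]
    exact subFP_ind ι hgen hind _ _ _ h

end Ind
end FPAux

namespace FPAux

section Groups

variable {R : Type*} [Ring R] {M H K : Type*} [Group M] [Group H] [Group K]

theorem augmentation_single (g : H) (r : R) :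
    augmentation R H (MonoidAlgebra.single g r) = r := by
  have := MonoidAlgebra.liftNC_single ((RingHom.id R : R →+* R) : R →+ R)
    ((1 : H →* R) : H → R) g r
  exact this.trans (by simp)

theorem augmentation_map (q : H →* K) (a : MonoidAlgebra R H) :
    augmentation R K (MonoidAlgebra.mapDomainRingHom R q a) = augmentation R H a := by
  induction a using MonoidAlgebra.induction_linear with
  | zero => simp
  | add x y hx hy => rw [map_add, map_add, map_add, hx, hy]
  | single g r =>
    rw [MonoidAlgebra.mapDomainRingHom_apply, MonoidAlgebra.mapDomain_single,
      augmentation_single, augmentation_single]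

theorem map_map_aug (i : M →* H) (q : H →* K) (hqi : ∀ m, q (i m) = 1) (c : MonoidAlgebra R M) :
    MonoidAlgebra.mapDomainRingHom R q (MonoidAlgebra.mapDomainRingHom R i c) =
      MonoidAlgebra.single 1 (augmentation R M c) := by
  induction c using MonoidAlgebra.induction_linear with
  | zero => simp
  | add x y hx hy => rw [map_add, map_add, map_add, hx, hy, MonoidAlgebra.single_add]
  | single g r =>
    rw [MonoidAlgebra.mapDomainRingHom_apply, MonoidAlgebra.mapDomainRingHom_apply,
      MonoidAlgebra.mapDomain_single, MonoidAlgebra.mapDomain_single, augmentation_single, hqi]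

theorem group_gen (i : M →* H) (q : H →* K) (hex : ∀ h, q h = 1 → ∃ m, i m = h)
    (s : K → H) (hs : ∀ k, q (s k) = k) :
    Gen (MonoidAlgebra.mapDomainRingHom R i) (fun k => MonoidAlgebra.single (s k) (1 : R)) := by
  intro a
  induction a using MonoidAlgebra.induction_linear with
  | zero => exact ⟨0, Finsupp.sum_zero_index⟩
  | add x y hx hy =>
    classical
    obtain ⟨c, rfl⟩ := hx
    obtain ⟨d, rfl⟩ := hy
    refine ⟨c + d, ?_⟩
    rw [Finsupp.sum_add_index']
    · intro t; rw [map_zero, mul_zero]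
    · intro t x y; rw [map_add, mul_add]
  | single g r =>
    obtain ⟨m, hm⟩ := hex ((s (q g))⁻¹ * g) (by rw [map_mul, map_inv, hs, inv_mul_cancel])
    refine ⟨Finsupp.single (q g) (MonoidAlgebra.single m r), ?_⟩
    rw [Finsupp.sum_single_index]
    · rw [MonoidAlgebra.mapDomainRingHom_apply, MonoidAlgebra.mapDomain_single,
        MonoidAlgebra.single_mul_single, hm, mul_inv_cancel_left, one_mul]
    · rw [map_zero, mul_zero]

theorem group_ind (i : M →* H) (hi : Function.Injective i) (q : H →* K) (hqi : ∀ m, q (i m) = 1)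
    (s : K → H) (hs : ∀ k, q (s k) = k) (x : K →₀ MonoidAlgebra R M)
    (hx : x.sum (fun k c => MonoidAlgebra.single (s k) (1 : R) *
      MonoidAlgebra.mapDomainRingHom R i c) = 0) : x = 0 := by
  ext k m
  have h := congrArg (fun a => a.coeff (s k * i m)) hx
  simp only [Finsupp.sum, MonoidAlgebra.coeff_sum, Finsupp.finsetSum_apply,
    MonoidAlgebra.coeff_single_mul_apply, one_mul, MonoidAlgebra.coeff_zero,
    Finsupp.coe_zero, Pi.zero_apply] at h
  rw [Finset.sum_eq_single k] at h
  · rw [inv_mul_cancel_left] at h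
    have h2 := Finsupp.mapDomain_apply hi (x k).coeff m
    exact h2.symm.trans h
  · intro k' _ hk
    refine Finsupp.mapDomain_of_notMem_range _ _ ?_
    rintro ⟨m', hm'⟩
    have := congrArg q hm'
    rw [hqi, map_mul, map_mul, map_inv, hs, hs, hqi, mul_one] at this
    exact hk (inv_mul_eq_one.1 this.symm)
  · intro hk
    rw [Finsupp.notMem_support_iff.1 hk, map_zero]
    simp

/-- A type synonym of the group ring, to avoid the coefficientwise action of other group rings. -/
def KR (R : Type*) [Ring R] (K : Type*) [Group K] := MonoidAlgebra R K

noncomputable instance (R : Type*) [Ring R] (K : Type*) [Group K] : Ring (KR R K) :=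
  inferInstanceAs (Ring (MonoidAlgebra R K))

noncomputable instance (R : Type*) [Ring R] (K : Type*) [Group K] : Module (KR R K) R :=
  trivialGroupRingModule R K

/-- For a group extension `M → H → K` with `M` of type `FP_n`, the properties `FP_n` of `H` and `K`
are equivalent. -/
theorem group_main (i : M →* H) (hi : Function.Injective i) (q : H →* K)
    (hq : Function.Surjective q) (hqi : ∀ m, q (i m) = 1) (hex : ∀ h, q h = 1 → ∃ m, i m = h)
    (n : ℕ) (hM : Group.IsTypeFP R M n) : Group.IsTypeFP R H n ↔ Group.IsTypeFP R K n := by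
  rw [isTypeFP_iff] at hM ⊢
  rw [isTypeFP_iff]
  change _ ↔ FP (KR R K) n R
  choose s hs using hq
  have e1 : ∀ (a : MonoidAlgebra R H) (b : MonoidAlgebra R K) (c : R),
      augmentation R K (MonoidAlgebra.mapDomainRingHom R q a * b) * c =
        augmentation R H a * (augmentation R K b * c) := by
    intro a b c
    rw [map_mul, augmentation_map, mul_assoc]
  have e2 : ∀ (k : K) (r : R),
      MonoidAlgebra.mapDomainRingHom R q (MonoidAlgebra.single (s k) (1 : R)) *
        MonoidAlgebra.single 1 r = MonoidAlgebra.single k r := by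
    intro k r
    rw [MonoidAlgebra.mapDomainRingHom_apply, MonoidAlgebra.mapDomain_single, hs,
      MonoidAlgebra.single_mul_single, mul_one, one_mul]
  have e3 : ∀ (c : MonoidAlgebra R M) (x : R),
      MonoidAlgebra.single 1 (augmentation R M c * x) =
        MonoidAlgebra.mapDomainRingHom R q (MonoidAlgebra.mapDomainRingHom R i c) *
          MonoidAlgebra.single 1 x := by
    intro c x
    rw [map_map_aug i q hqi, MonoidAlgebra.single_mul_single, one_mul]
  let π : MonoidAlgebra R H →+* KR R K := MonoidAlgebra.mapDomainRingHom R q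
  let inst : Module (MonoidAlgebra R H) (KR R K) := Module.compHom _ π
  have hsmul : ∀ (a : MonoidAlgebra R H) (b : KR R K), a • b = π a * b := fun _ _ => rfl
  have : IsScalarTower (MonoidAlgebra R H) (KR R K) (KR R K) :=
    ⟨fun a b c => by rw [hsmul, hsmul, smul_eq_mul, smul_eq_mul, mul_assoc]⟩
  have : IsScalarTower (MonoidAlgebra R H) (KR R K) R :=
    ⟨fun a b c => by
      rw [hsmul]
      exact e1 a b c⟩
  let θ : R →+ KR R K := MonoidAlgebra.singleAddHom (1 : K)
  have hterm : ∀ (k : K) (r : R), (MonoidAlgebra.single (s k) (1 : R)) • θ r =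
      (MonoidAlgebra.single k r : MonoidAlgebra R K) := by
    intro k r
    rw [hsmul]
    exact e2 k r
  have hsum : ∀ x : K →₀ R, x.sum (fun k r => (MonoidAlgebra.single (s k) (1 : R)) • θ r) =
      (MonoidAlgebra.ofCoeff x : MonoidAlgebra R K) := by
    intro x
    simp only [hterm]
    exact MonoidAlgebra.sum_coeff_single (MonoidAlgebra.ofCoeff x)
  have hB : FP (MonoidAlgebra R H) n (KR R K) := by
    refine FP.ind (X := R) (MonoidAlgebra.mapDomainRingHom R i) (group_gen i q hex s hs)
      (group_ind i hi q hqi s hs) θ ?_ ?_ ?_ n hM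
    · intro c x
      rw [hsmul]
      exact e3 c x
    · intro x hx
      rw [hsum] at hx
      exact congrArg MonoidAlgebra.coeff hx
    · intro y
      exact ⟨MonoidAlgebra.coeff y, hsum _⟩
  constructor
  · intro h
    exact FP.of_equiv ULift.moduleEquiv
      (down_univ n hB (ULift R) (FP.of_equiv ULift.moduleEquiv.symm h))
  · intro h
    exact FP.of_equiv ULift.moduleEquiv
      (up_univ n hB (ULift R) (FP.of_equiv ULift.moduleEquiv.symm h))

theorem isTypeFP_mono {n m : ℕ} (hnm : n ≤ m) (h : Group.IsTypeFP R H m) :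
    Group.IsTypeFP R H n := by
  rw [isTypeFP_iff] at h ⊢
  exact h.mono hnm

end Groups

end FPAux

/-- Strengthened homological extension inheritance: let `R` be a nontrivial ring,
`n < m`, and let `p : G → Q` be a surjective group homomorphism with kernel `N`.
If every subgroup of `Q` of type `FP_n(R)` is of type `FP_m(R)`, and for every
subgroup `H` of `G` of type `FP_n(R)` the intersection `N ⊓ H` is of type `FP_m(R)`,
then every subgroup of `G` of type `FP_n(R)` is of type `FP_m(R)`. -/
theorem fp_coherent_of_group_extension_of_intersections_fp {R : Type*} [Ring R]
    [Nontrivial R] {G Q : Type*} [Group G] [Group Q] (n m : ℕ) (hnm : n < m)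
    (p : G →* Q) (hp : Function.Surjective p) (N : Subgroup G) (hN : N = p.ker)
    (hQ : ∀ K : Subgroup Q, Group.IsTypeFP R K n → Group.IsTypeFP R K m)
    (hint : ∀ H : Subgroup G, Group.IsTypeFP R H n → Group.IsTypeFP R ↥(N ⊓ H) m) :
    ∀ H : Subgroup G, Group.IsTypeFP R H n → Group.IsTypeFP R H m := by
  intro H hH
  have hM := hint H hH
  let i : ↥(N ⊓ H) →* H := Subgroup.inclusion inf_le_right
  let q : H →* H.map p := p.subgroupMap H
  have hq : Function.Surjective q := p.subgroupMap_surjective H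
  have hi : Function.Injective i := Subgroup.inclusion_injective _
  have hqi : ∀ x, q (i x) = 1 := by
    rintro ⟨x, hx⟩
    apply Subtype.ext
    have hxN : x ∈ N := hx.1
    rw [hN] at hxN
    exact hxN
  have hex : ∀ h, q h = 1 → ∃ x, i x = h := by
    rintro ⟨h, hh⟩ h1
    have h2 : p h = 1 := congrArg Subtype.val h1
    refine ⟨⟨h, ?_, hh⟩, rfl⟩
    rw [hN]
    exact h2
  have hK := (FPAux.group_main i hi q hq hqi hex n (FPAux.isTypeFP_mono hnm.le hM)).1 hH
  exact (FPAux.group_main i hi q hq hqi hex m hM).2 (hQ _ hK)
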